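/- Let Ω be a bounded domain of ℝⁿ, n ≥ 2, let p > 1, a ≥ 0, b ∈ ℝ, and let Q be a cube compactly contained in Ω. If the weighted Korn inequality ∫_Ω |Dv(x)|^p ρ(x)^a dx ≤ C { ∫_Ω |ε(v)(x)|^p ρ(x)^{b−p} dx + ∫_Q |Dv(x)|^p ρ(x)^a dx } holds for all v ∈ W^{1,p}(Ω,ρ^a)ⁿ, then the weighted Poincaré inequality ∫_Ω |u(x) − u_{Ω,a}|^p ρ(x)^a dx ≤ C' ∫_Ω |∇u(x)|^p ρ(x)^{b−p} dx holds for all u ∈ W^{1,p}(Ω,ρ^a,ρ^{b−p}). -/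

import Mathlib

open MeasureTheory Set Filter
open scoped ENNReal NNReal Topology

noncomputable section

abbrev Evec (n : ℕ) := EuclideanSpace ℝ (Fin n)

/-- `ρ(x) = dist(x, ∂Ω)`, the distance to the boundary of `Ω`. -/
def bdist {n : ℕ} (Ω : Set (Evec n)) (x : Evec n) : ℝ := Metric.infDist x (frontier Ω)

/-- A bounded domain: open, connected and bounded. -/
def IsBoundedDomain {n : ℕ} (Ω : Set (Evec n)) : Prop :=
  IsOpen Ω ∧ IsConnected Ω ∧ Bornology.IsBounded Ω

/-- A closed cube in `ℝⁿ`. -/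
def IsClosedCube {n : ℕ} (Q : Set (Evec n)) : Prop :=
  ∃ (c : Evec n) (r : ℝ), 0 < r ∧ Q = {x : Evec n | ∀ i, |x i - c i| ≤ r}

/-- The weighted `p`-energy `∫_S |g(x)|^p ρ(x)^a dx`, where `ρ` is the distance
to the boundary of `Ω`. -/
def wIp {n : ℕ} (Ω S : Set (Evec n)) (p a : ℝ) (g : Evec n → ℝ) : ℝ≥0∞ :=
  ∫⁻ x in S, ENNReal.ofReal (|g x| ^ p * bdist Ω x ^ a)

/-- The weighted `L^p(S, ρ^a)` norm `(∫_S |g(x)|^p ρ(x)^a dx)^{1/p}`. -/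
def wLp {n : ℕ} (Ω S : Set (Evec n)) (p a : ℝ) (g : Evec n → ℝ) : ℝ≥0∞ :=
  wIp Ω S p a g ^ (1 / p)

/-- The weighted average `u_{Ω,a} = (∫_Ω ρ^a)⁻¹ ∫_Ω u ρ^a`. -/
def wAvg {n : ℕ} (Ω : Set (Evec n)) (a : ℝ) (u : Evec n → ℝ) : ℝ :=
  (∫ x in Ω, bdist Ω x ^ a)⁻¹ * ∫ x in Ω, u x * bdist Ω x ^ a

/-- `|∇u(x)|` for a scalar function `u`. -/
def gradLen {n : ℕ} (u : Evec n → ℝ) (x : Evec n) : ℝ := ‖fderiv ℝ u x‖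

/-- The entry `∂v_i/∂x_j (x)` of the gradient matrix `Dv`. -/
def pder {n : ℕ} (v : Evec n → Evec n) (i j : Fin n) (x : Evec n) : ℝ :=
  fderiv ℝ v x (EuclideanSpace.single j 1) i

/-- `|Dv(x)|`, the (Frobenius) norm of the gradient matrix of a vector field `v`. -/
def DvLen {n : ℕ} (v : Evec n → Evec n) (x : Evec n) : ℝ :=
  Real.sqrt (∑ i, ∑ j, pder v i j x ^ 2)

/-- `|ε(v)(x)|`, the norm of the symmetric part `ε_{ij}(v) = (∂v_i/∂x_j + ∂v_j/∂x_i)/2`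
of the gradient matrix. -/
def epsLen {n : ℕ} (v : Evec n → Evec n) (x : Evec n) : ℝ :=
  Real.sqrt (∑ i, ∑ j, ((pder v i j x + pder v j i x) / 2) ^ 2)

/-- `u ∈ W^{1,p}(Ω, ρ^a, ρ^b)` (scalar case). -/
def MemW1 {n : ℕ} (Ω : Set (Evec n)) (p a b : ℝ) (u : Evec n → ℝ) : Prop :=
  DifferentiableOn ℝ u Ω ∧ wIp Ω Ω p a u < ⊤ ∧ wIp Ω Ω p b (gradLen u) < ⊤

/-- `v ∈ W^{1,p}(Ω, ρ^a, ρ^b)ⁿ` (vector case). -/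
def MemW1Vec {n : ℕ} (Ω : Set (Evec n)) (p a b : ℝ) (v : Evec n → Evec n) : Prop :=
  DifferentiableOn ℝ v Ω ∧ wIp Ω Ω p a (fun x => ‖v x‖) < ⊤ ∧ wIp Ω Ω p b (DvLen v) < ⊤

/-- The weighted Poincaré inequality `(P_{p,a,b})`: there is `C > 0` such that
`∫_Ω |u - u_{Ω,a}|^p ρ^a ≤ C ∫_Ω |∇u|^p ρ^b` for all `u ∈ W^{1,p}(Ω,ρ^a,ρ^b)`. -/
def PoincareIneq {n : ℕ} (Ω : Set (Evec n)) (p a b : ℝ) : Prop :=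
  ∃ C > 0, ∀ u : Evec n → ℝ, MemW1 Ω p a b u →
    wIp Ω Ω p a (fun x => u x - wAvg Ω a u) ≤ ENNReal.ofReal C * wIp Ω Ω p b (gradLen u)

theorem rpow_lintegral_le {α : Type*} [MeasurableSpace α] (μ : Measure α) {p : ℝ}
    (hp : 1 < p) {f : α → ℝ≥0∞} (hf : AEMeasurable f μ) :
    (∫⁻ x, f x ∂μ) ^ p ≤ μ univ ^ (p - 1) * ∫⁻ x, f x ^ p ∂μ := by
  have hpq := Real.HolderConjugate.conjExponent hp
  have h := ENNReal.lintegral_mul_le_Lp_mul_Lq μ hpq hf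
    (aemeasurable_const (b := (1 : ℝ≥0∞)))
  have hp0 : 0 < p := by linarith
  have h2 := ENNReal.rpow_le_rpow h hp0.le
  simp only [Pi.mul_apply, mul_one, ENNReal.one_rpow, lintegral_const, one_mul] at h2
  rw [ENNReal.mul_rpow_of_nonneg _ _ hp0.le, ← ENNReal.rpow_mul, ← ENNReal.rpow_mul] at h2
  have e1 : 1 / p * p = 1 := by field_simp
  have e2 : 1 / p.conjExponent * p = p - 1 := by
    have : p - 1 ≠ 0 := by linarith
    rw [Real.conjExponent]; field_simp
  rw [e1, e2, ENNReal.rpow_one, mul_comm] at h2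
  exact h2

theorem lintegral_segment_le {n : ℕ} {Q : Set (Evec n)} (hQm : MeasurableSet Q)
    (hQc : Convex ℝ Q) {f : Evec n → ℝ≥0∞} (hf : Measurable f) {x : Evec n} (hx : x ∈ Q)
    {t : ℝ} (ht : 1 / 2 ≤ t) (ht1 : t ≤ 1) :
    ∫⁻ y in Q, f (x + t • (y - x)) ≤ 2 ^ n * ∫⁻ y in Q, f y := by
  have ht0 : 0 < t := by linarith
  have h1 : ∫⁻ y in Q, f (x + t • (y - x)) ≤
      ∫⁻ y, Q.indicator f ((x - t • x) + t • y) := by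
    rw [← lintegral_indicator hQm]
    refine lintegral_mono fun y => ?_
    by_cases hy : y ∈ Q
    · have e : x + t • (y - x) = (x - t • x) + t • y := by rw [smul_sub]; abel
      have hm : x + t • (y - x) ∈ Q := hQc.add_smul_sub_mem hx hy ⟨ht0.le, ht1⟩
      rw [indicator_of_mem hy, ← e, indicator_of_mem hm]
    · simp [hy]
  have hF : Measurable (Q.indicator f) := hf.indicator hQm
  have h2 : ∫⁻ y, Q.indicator f ((x - t • x) + t • y) =
      ENNReal.ofReal |(t ^ n)⁻¹| * ∫⁻ y in Q, f y := by
    have h3 := lintegral_map (μ := (volume : Measure (Evec n)))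
      (f := fun z => Q.indicator f ((x - t • x) + z)) (g := fun y => t • y)
      (hF.comp (measurable_const_add _)) (measurable_const_smul t)
    rw [← h3, Measure.map_addHaar_smul _ ht0.ne', lintegral_smul_measure,
      lintegral_add_left_eq_self (fun z => Q.indicator f z), lintegral_indicator hQm]
    simp
  rw [h2] at h1
  refine h1.trans ?_
  gcongr
  rw [abs_of_pos (by positivity)]
  calc ENNReal.ofReal (t ^ n)⁻¹ ≤ ENNReal.ofReal (2 ^ n) := by
        apply ENNReal.ofReal_le_ofReal
        rw [← inv_pow]
        gcongr
        rw [inv_le_comm₀ ht0 (by norm_num)]; linarith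
    _ = 2 ^ n := by
        rw [ENNReal.ofReal_pow (by norm_num)]; simp

theorem lintegral_lintegral_segment_le {n : ℕ} {Q : Set (Evec n)} (hQm : MeasurableSet Q)
    (hQc : Convex ℝ Q) {f : Evec n → ℝ≥0∞} (hf : Measurable f) {t : ℝ} (ht : t ∈ Icc (0 : ℝ) 1) :
    ∫⁻ y in Q, ∫⁻ x in Q, f (y + t • (x - y)) ≤ volume Q * (2 ^ n * ∫⁻ y in Q, f y) := by
  have key : ∀ t : ℝ, 1 / 2 ≤ t → t ≤ 1 →
      ∫⁻ y in Q, ∫⁻ x in Q, f (y + t • (x - y)) ≤ volume Q * (2 ^ n * ∫⁻ y in Q, f y) := by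
    intro t h1 h2
    refine (setLIntegral_mono' hQm fun y hy =>
      lintegral_segment_le hQm hQc hf hy h1 h2).trans ?_
    rw [lintegral_const, Measure.restrict_apply_univ, mul_comm]
  rcases le_total (1 / 2) t with h | h
  · exact key t h ht.2
  · rw [lintegral_lintegral_swap]
    · refine le_trans (le_of_eq ?_) (key (1 - t) (by linarith) (by linarith [ht.1]))
      congr! 5 with x y
      module
    · exact (hf.comp (by fun_prop)).aemeasurable

theorem enorm_sub_le_lintegral_segment {n : ℕ} {Ω : Set (Evec n)} (hΩ : IsOpen Ω)
    {u : Evec n → ℝ} (hu : DifferentiableOn ℝ u Ω) {Q : Set (Evec n)} (hQΩ : Q ⊆ Ω)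
    (hQc : Convex ℝ Q) {x y : Evec n} (hx : x ∈ Q) (hy : y ∈ Q) :
    ‖u x - u y‖ₑ ≤ ∫⁻ t in Icc (0 : ℝ) 1,
      ‖x - y‖ₑ * ENNReal.ofReal (gradLen u (y + t • (x - y))) := by
  set g : ℝ → ℝ := fun t => fderiv ℝ u (y + t • (x - y)) (x - y) with hg
  have hgm : Measurable g := by
    have h1 : Measurable fun z => fderiv ℝ u z (x - y) := measurable_fderiv_apply_const ℝ u (x - y)
    exact h1.comp (by fun_prop)
  have hder : ∀ t ∈ uIcc (0 : ℝ) 1, HasDerivAt (fun t : ℝ => u (y + t • (x - y))) (g t) t := by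
    intro t ht
    rw [uIcc_of_le zero_le_one] at ht
    have hm : y + t • (x - y) ∈ Q := hQc.add_smul_sub_mem hy hx ht
    have h1 := (hu.differentiableAt (hΩ.mem_nhds (hQΩ hm))).hasFDerivAt
    have h2 : HasDerivAt (fun t : ℝ => y + t • (x - y)) (x - y) t := by
      simpa using ((hasDerivAt_id t).smul_const (x - y)).const_add y
    exact h1.comp_hasDerivAt t h2
  have hle : ∀ t, ‖g t‖ₑ ≤ ‖x - y‖ₑ * ENNReal.ofReal (gradLen u (y + t • (x - y))) := by
    intro t
    rw [gradLen, ofReal_norm, mul_comm]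
    exact (fderiv ℝ u (y + t • (x - y))).le_opENorm _
  have hle' := lintegral_mono (μ := volume.restrict (Icc (0 : ℝ) 1)) hle
  refine le_trans ?_ hle'
  rw [← restrict_Ioc_eq_restrict_Icc]
  by_cases hfin : ∫⁻ t in Ioc (0 : ℝ) 1, ‖g t‖ₑ = ⊤
  · rw [hfin]; exact le_top
  · have hint : IntervalIntegrable g volume 0 1 := by
      rw [intervalIntegrable_iff_integrableOn_Ioc_of_le zero_le_one]
      exact ⟨hgm.aestronglyMeasurable, lt_top_iff_ne_top.2 hfin⟩
    have h := intervalIntegral.integral_eq_sub_of_hasDerivAt hder hint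
    have e : u x - u y = ∫ t in Ioc (0 : ℝ) 1, g t := by
      rw [← intervalIntegral.integral_of_le zero_le_one, h]; simp
    rw [e]
    exact enorm_integral_le_lintegral_enorm _

theorem exists_lintegral_sub_le_of_convex {n : ℕ} {Ω Q : Set (Evec n)} (hΩ : IsOpen Ω)
    (hQΩ : Q ⊆ Ω) (hQc : Convex ℝ Q) (hQk : IsCompact Q) (hQ0 : volume Q ≠ 0) {p : ℝ}
    (hp : 1 < p) :
    ∃ K : ℝ≥0∞, K ≠ ⊤ ∧ ∀ u : Evec n → ℝ, DifferentiableOn ℝ u Ω →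
      ∃ c : ℝ, ∫⁻ x in Q, ENNReal.ofReal (|u x - c| ^ p) ≤
        K * ∫⁻ x in Q, ENNReal.ofReal (gradLen u x ^ p) := by
  have hp0 : 0 < p := by linarith
  have hQm : MeasurableSet Q := hQk.measurableSet
  have hQfin : volume Q ≠ ⊤ := hQk.measure_lt_top.ne
  obtain ⟨d, hd⟩ := hQk.isBounded.exists_norm_le
  set D : ℝ≥0∞ := ENNReal.ofReal (2 * d) with hD
  refine ⟨D ^ p * 2 ^ n, ENNReal.mul_ne_top (ENNReal.rpow_ne_top_of_nonneg hp0.le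
    ENNReal.ofReal_ne_top) (by simp), fun u hu => ?_⟩
  set f : Evec n → ℝ≥0∞ := fun x => ENNReal.ofReal (gradLen u x ^ p) with hfdef
  have hgm : Measurable (gradLen u) := (measurable_fderiv ℝ u).norm
  have hf : Measurable f := (hgm.pow_const p).ennreal_ofReal
  set H : Evec n → ℝ≥0∞ := fun y =>
    ∫⁻ x in Q, ∫⁻ t in Icc (0 : ℝ) 1, f (y + t • (x - y)) with hH
  have hm3 : Measurable fun q : (Evec n × Evec n) × ℝ => f (q.1.1 + q.2 • (q.1.2 - q.1.1)) :=
    hf.comp (by fun_prop)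
  have hm2 : Measurable fun q : Evec n × Evec n =>
      ∫⁻ t in Icc (0 : ℝ) 1, f (q.1 + t • (q.2 - q.1)) := hm3.lintegral_prod_right'
  have hHm : Measurable H := hm2.lintegral_prod_right'
  have hHint : ∫⁻ y in Q, H y ≤ volume Q * (2 ^ n * ∫⁻ y in Q, f y) := by
    have e1 : ∀ y, H y = ∫⁻ t in Icc (0 : ℝ) 1, ∫⁻ x in Q, f (y + t • (x - y)) := by
      intro y
      rw [hH]
      exact lintegral_lintegral_swap (hf.comp (by fun_prop)).aemeasurable
    have hm2' : Measurable fun q : Evec n × ℝ =>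
        ∫⁻ x in Q, f (q.1 + q.2 • (x - q.1)) := by
      have : Measurable fun q : (Evec n × ℝ) × Evec n =>
        f (q.1.1 + q.1.2 • (q.2 - q.1.1)) := hf.comp (by fun_prop)
      exact this.lintegral_prod_right'
    simp_rw [e1]
    rw [lintegral_lintegral_swap hm2'.aemeasurable]
    refine (setLIntegral_mono' measurableSet_Icc fun t ht =>
      lintegral_lintegral_segment_le hQm hQc hf ht).trans ?_
    simp
  obtain ⟨y, hy, hHy⟩ := exists_le_setLAverage hQ0 hQfin hHm.aemeasurable
  have hHy' : H y ≤ 2 ^ n * ∫⁻ y in Q, f y := by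
    refine hHy.trans ?_
    rw [setLAverage_eq]
    refine (ENNReal.div_le_div_right hHint _).trans ?_
    rw [mul_comm, mul_div_assoc, ENNReal.div_self hQ0 hQfin, mul_one]
  refine ⟨u y, ?_⟩
  calc ∫⁻ x in Q, ENNReal.ofReal (|u x - u y| ^ p)
      ≤ ∫⁻ x in Q, D ^ p * ∫⁻ t in Icc (0 : ℝ) 1, f (y + t • (x - y)) := by
        refine setLIntegral_mono' hQm fun x hx => ?_
        have h1 := enorm_sub_le_lintegral_segment hΩ hu hQΩ hQc hx hy
        have hxy : ‖x - y‖ₑ ≤ D := by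
          rw [hD, ← ofReal_norm]
          apply ENNReal.ofReal_le_ofReal
          linarith [norm_sub_le x y, hd x hx, hd y hy]
        have h2 := ENNReal.rpow_le_rpow h1 hp0.le
        rw [← ENNReal.ofReal_rpow_of_nonneg (abs_nonneg _) hp0.le, ← Real.norm_eq_abs,
          ofReal_norm]
        refine h2.trans ?_
        have hmeas : Measurable fun t : ℝ =>
            ENNReal.ofReal (gradLen u (y + t • (x - y))) :=
          (hgm.comp (by fun_prop)).ennreal_ofReal
        rw [lintegral_const_mul _ hmeas, ENNReal.mul_rpow_of_nonneg _ _ hp0.le]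
        gcongr
        refine (rpow_lintegral_le _ hp hmeas.aemeasurable).trans ?_
        simp only [Measure.restrict_apply_univ, Real.volume_Icc, sub_zero, ENNReal.ofReal_one,
          ENNReal.one_rpow, one_mul]
        refine le_of_eq (lintegral_congr fun t => ?_)
        exact ENNReal.ofReal_rpow_of_nonneg (norm_nonneg _) hp0.le
    _ = D ^ p * H y := by
        have hm1 : Measurable fun q : Evec n × ℝ => f (y + q.2 • (q.1 - y)) :=
          hf.comp (by fun_prop)
        exact lintegral_const_mul _ hm1.lintegral_prod_right'
    _ ≤ D ^ p * (2 ^ n * ∫⁻ y in Q, f y) := by gcongr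
    _ = _ := by rw [mul_assoc]

theorem measurable_bdist {n : ℕ} (Ω : Set (Evec n)) : Measurable (bdist Ω) :=
  (Metric.continuous_infDist_pt _).measurable

theorem bdist_nonneg {n : ℕ} (Ω : Set (Evec n)) (x : Evec n) : 0 ≤ bdist Ω x :=
  Metric.infDist_nonneg

theorem frontier_nonempty_of_isBoundedDomain {n : ℕ} (hn : 2 ≤ n) {Ω : Set (Evec n)}
    (hΩ : IsBoundedDomain Ω) : (frontier Ω).Nonempty := by
  rw [nonempty_frontier_iff]
  refine ⟨hΩ.2.1.nonempty, fun h => ?_⟩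
  have : Nontrivial (Evec n) := by
    have : Nonempty (Fin n) := ⟨⟨0, by lia⟩⟩
    infer_instance
  have hb := hΩ.2.2
  rw [h] at hb
  exact NormedSpace.unbounded_univ ℝ (Evec n) hb

theorem bdist_pos {n : ℕ} {Ω : Set (Evec n)} (hΩ : IsOpen Ω) (hne : (frontier Ω).Nonempty)
    {x : Evec n} (hx : x ∈ Ω) : 0 < bdist Ω x := by
  refine (isClosed_frontier.notMem_iff_infDist_pos hne).1 fun h => ?_
  rw [hΩ.frontier_eq] at h
  exact h.2 hx

theorem exists_bdist_rpow_le_of_bounded {n : ℕ} {Ω : Set (Evec n)} (hΩ : IsOpen Ω)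
    (hb : Bornology.IsBounded Ω) (hne : (frontier Ω).Nonempty) {a b : ℝ} (hab : b ≤ a) :
    ∃ M : ℝ, 0 ≤ M ∧ ∀ x ∈ Ω, bdist Ω x ^ a ≤ M * bdist Ω x ^ b := by
  obtain ⟨D, hD⟩ := hb.isCompact_closure.exists_bound_of_continuousOn
    (Metric.continuous_infDist_pt (frontier Ω)).continuousOn
  refine ⟨|D| ^ (a - b), by positivity, fun x hx => ?_⟩
  have hpos := bdist_pos hΩ hne hx
  have h1 : bdist Ω x ≤ |D| :=
    (le_abs_self _).trans ((hD x (subset_closure hx)).trans (le_abs_self D))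
  have h2 : bdist Ω x ^ a = bdist Ω x ^ (a - b) * bdist Ω x ^ b := by
    rw [← Real.rpow_add hpos]; simp
  rw [h2]
  gcongr

theorem exists_bdist_rpow_le_of_isCompact {n : ℕ} {Ω Q : Set (Evec n)} (hΩ : IsOpen Ω)
    (hne : (frontier Ω).Nonempty) (hQ : IsCompact Q) (hQΩ : Q ⊆ Ω) (a b : ℝ) :
    ∃ M : ℝ, 0 ≤ M ∧ ∀ x ∈ Q, bdist Ω x ^ a ≤ M * bdist Ω x ^ b := by
  have hpos : ∀ x ∈ Q, 0 < bdist Ω x := fun x hx => bdist_pos hΩ hne (hQΩ hx)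
  have hc : ContinuousOn (fun x => bdist Ω x ^ (a - b)) Q :=
    (Metric.continuous_infDist_pt (frontier Ω)).continuousOn.rpow_const
      fun x hx => Or.inl (hpos x hx).ne'
  obtain ⟨D, hD⟩ := hQ.exists_bound_of_continuousOn hc
  refine ⟨|D|, abs_nonneg _, fun x hx => ?_⟩
  have h2 : bdist Ω x ^ a = bdist Ω x ^ (a - b) * bdist Ω x ^ b := by
    rw [← Real.rpow_add (hpos x hx)]; simp
  rw [h2]
  have h3 := (le_abs_self _).trans ((hD x hx).trans (le_abs_self D))
  have := bdist_nonneg Ω x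
  gcongr

theorem wIp_le_add {n : ℕ} (Ω : Set (Evec n)) {S : Set (Evec n)} {p : ℝ} (a : ℝ) (hp : 0 ≤ p)
    (hS : MeasurableSet S) {g f h : Evec n → ℝ} (hh : Measurable h) {K L : ℝ} (hK : 0 ≤ K)
    (hL : 0 ≤ L) (hle : ∀ x ∈ S, |g x| ≤ K * |f x| + L * |h x|) :
    wIp Ω S p a g ≤
      ENNReal.ofReal ((2 * K) ^ p) * wIp Ω S p a f +
        ENNReal.ofReal ((2 * L) ^ p) * wIp Ω S p a h := by
  simp only [wIp]
  have hm : Measurable fun x => ENNReal.ofReal (|h x| ^ p * bdist Ω x ^ a) :=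
    (((measurable_abs.comp hh).pow_const p).mul
      ((measurable_bdist Ω).pow_const a)).ennreal_ofReal
  rw [← lintegral_const_mul' _ _ ENNReal.ofReal_ne_top,
    ← lintegral_const_mul' _ _ ENNReal.ofReal_ne_top,
    ← lintegral_add_right _ (hm.const_mul _)]
  refine setLIntegral_mono' hS fun x hx => ?_
  have hw : 0 ≤ bdist Ω x ^ a := Real.rpow_nonneg (bdist_nonneg Ω x) a
  rw [← ENNReal.ofReal_mul (by positivity), ← ENNReal.ofReal_mul (by positivity),
    ← ENNReal.ofReal_add (by positivity) (by positivity)]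
  apply ENNReal.ofReal_le_ofReal
  rw [← mul_assoc, ← mul_assoc, ← add_mul]
  refine mul_le_mul_of_nonneg_right ?_ hw
  rw [← Real.mul_rpow (by positivity) (abs_nonneg _),
    ← Real.mul_rpow (by positivity) (abs_nonneg _)]
  have h0 := hle x hx
  have hf0 : 0 ≤ K * |f x| := by positivity
  have hh0 : 0 ≤ L * |h x| := by positivity
  rcases le_total (K * |f x|) (L * |h x|) with hc | hc
  · have : |g x| ^ p ≤ (2 * L * |h x|) ^ p :=
      Real.rpow_le_rpow (abs_nonneg _) (by linarith) hp
    have : 0 ≤ (2 * K * |f x|) ^ p := by positivity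
    linarith
  · have : |g x| ^ p ≤ (2 * K * |f x|) ^ p :=
      Real.rpow_le_rpow (abs_nonneg _) (by linarith) hp
    have : 0 ≤ (2 * L * |h x|) ^ p := by positivity
    linarith

theorem wIp_le_mul {n : ℕ} (Ω : Set (Evec n)) {S : Set (Evec n)} {p : ℝ} (a : ℝ) (hp : 0 ≤ p)
    (hS : MeasurableSet S) {g f : Evec n → ℝ} {K : ℝ} (hK : 0 ≤ K)
    (hle : ∀ x ∈ S, |g x| ≤ K * |f x|) :
    wIp Ω S p a g ≤ ENNReal.ofReal (K ^ p) * wIp Ω S p a f := by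
  simp only [wIp]
  rw [← lintegral_const_mul' _ _ ENNReal.ofReal_ne_top]
  refine setLIntegral_mono' hS fun x hx => ?_
  have hw : 0 ≤ bdist Ω x ^ a := Real.rpow_nonneg (bdist_nonneg Ω x) a
  rw [← ENNReal.ofReal_mul (by positivity), ← mul_assoc,
    ← Real.mul_rpow hK (abs_nonneg _)]
  exact ENNReal.ofReal_le_ofReal (mul_le_mul_of_nonneg_right
    (Real.rpow_le_rpow (abs_nonneg _) (hle x hx) hp) hw)

theorem wIp_le_of_weight_le {n : ℕ} (Ω : Set (Evec n)) {S : Set (Evec n)} (p : ℝ) {a b : ℝ}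
    (hS : MeasurableSet S) (g : Evec n → ℝ) {M : ℝ} (hM : 0 ≤ M)
    (hle : ∀ x ∈ S, bdist Ω x ^ a ≤ M * bdist Ω x ^ b) :
    wIp Ω S p a g ≤ ENNReal.ofReal M * wIp Ω S p b g := by
  simp only [wIp]
  rw [← lintegral_const_mul' _ _ ENNReal.ofReal_ne_top]
  refine setLIntegral_mono' hS fun x hx => ?_
  rw [← ENNReal.ofReal_mul hM]
  apply ENNReal.ofReal_le_ofReal
  rw [mul_left_comm]
  exact mul_le_mul_of_nonneg_left (hle x hx) (by positivity)

theorem wIp_mono_set {n : ℕ} (Ω : Set (Evec n)) {S T : Set (Evec n)} (p a : ℝ) (hST : S ⊆ T)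
    (g : Evec n → ℝ) : wIp Ω S p a g ≤ wIp Ω T p a g :=
  lintegral_mono_set hST

theorem wIp_lt_top_of_bounded {n : ℕ} {Ω : Set (Evec n)} {p a : ℝ} (hp : 0 ≤ p) (ha : 0 ≤ a)
    (hΩ : IsOpen Ω) (hb : Bornology.IsBounded Ω) (hne : (frontier Ω).Nonempty) {g : Evec n → ℝ}
    {K : ℝ} (hg : ∀ x ∈ Ω, |g x| ≤ K) : wIp Ω Ω p a g < ⊤ := by
  obtain ⟨M, hM, hMle⟩ := exists_bdist_rpow_le_of_bounded hΩ hb hne ha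
  have h : wIp Ω Ω p a g ≤ ∫⁻ _ in Ω, ENNReal.ofReal (|K| ^ p * M) := by
    refine setLIntegral_mono' hΩ.measurableSet fun x hx => ENNReal.ofReal_le_ofReal ?_
    have h1 := hMle x hx
    rw [Real.rpow_zero, mul_one] at h1
    have h2 : |g x| ^ p ≤ |K| ^ p :=
      Real.rpow_le_rpow (abs_nonneg _) ((hg x hx).trans (le_abs_self K)) hp
    exact mul_le_mul h2 h1 (Real.rpow_nonneg (bdist_nonneg Ω x) a) (by positivity)
  refine h.trans_lt ?_
  rw [lintegral_const, Measure.restrict_apply_univ]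
  exact ENNReal.mul_lt_top ENNReal.ofReal_lt_top hb.measure_lt_top

theorem wIp_sub_wAvg_le {n : ℕ} {Ω : Set (Evec n)} (hΩ : IsOpen Ω) (hΩne : Ω.Nonempty)
    (hb : Bornology.IsBounded Ω) (hne : (frontier Ω).Nonempty) {p a : ℝ} (hp : 1 < p)
    (ha : 0 ≤ a) {u : Evec n → ℝ} (hu : ContinuousOn u Ω) {c : ℝ}
    (hfin : wIp Ω Ω p a (fun x => u x - c) < ⊤) :
    wIp Ω Ω p a (fun x => u x - wAvg Ω a u) ≤
      ENNReal.ofReal (2 ^ p) * 2 * wIp Ω Ω p a (fun x => u x - c) := by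
  have hp0 : 0 < p := by linarith
  set I := wIp Ω Ω p a (fun x => u x - c) with hI
  set ω : Evec n → ℝ := fun x => bdist Ω x ^ a with hω
  have hωm : Measurable ω := (measurable_bdist Ω).pow_const a
  have hω0 : ∀ x, 0 ≤ ω x := fun x => Real.rpow_nonneg (bdist_nonneg Ω x) a
  set w : Evec n → ℝ := fun x => u x - c with hw
  have hwm : AEMeasurable w (volume.restrict Ω) :=
    (hu.sub continuousOn_const).aemeasurable hΩ.measurableSet
  set W : ℝ≥0∞ := ∫⁻ x in Ω, ENNReal.ofReal (ω x) with hW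
  have hWone : wIp Ω Ω p a (fun _ => 1) = W := by
    simp [wIp, hW, hω]
  have hWtop : W ≠ ⊤ := by
    rw [← hWone]
    exact (wIp_lt_top_of_bounded hp0.le ha hΩ hb hne (K := 1) (by simp)).ne
  have hWpos : W ≠ 0 := by
    rw [hW, Ne, lintegral_eq_zero_iff hωm.ennreal_ofReal]
    intro h
    rw [Filter.EventuallyEq, ae_restrict_iff' hΩ.measurableSet] at h
    have h2 : volume Ω = 0 := by
      refine measure_mono_null (fun x hx => ?_) (ae_iff.1 h)
      simp only [mem_ofPred_eq, Classical.not_imp]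
      refine ⟨hx, ?_⟩
      have : 0 < ω x := Real.rpow_pos_of_pos (bdist_pos hΩ hne hx) a
      simpa using this
    exact (hΩ.measure_pos volume hΩne).ne' h2
  have hωint : IntegrableOn ω Ω :=
    ⟨hωm.aestronglyMeasurable, by
      rw [hasFiniteIntegral_iff_ofReal (ae_of_all _ hω0)]; exact lt_top_iff_ne_top.2 hWtop⟩
  set N : ℝ≥0∞ := ∫⁻ x in Ω, ‖w x * ω x‖ₑ with hN
  have hNp : N ^ p ≤ W ^ (p - 1) * I := by
    set μ := (volume.restrict Ω).withDensity fun x => ENNReal.ofReal (ω x) with hμ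
    have hac : μ ≪ volume.restrict Ω := withDensity_absolutelyContinuous _ _
    have h := rpow_lintegral_le μ hp (f := fun x => ‖w x‖ₑ) (hwm.mono_ac hac).enorm
    rw [hμ, lintegral_withDensity_eq_lintegral_mul₀ hωm.ennreal_ofReal.aemeasurable hwm.enorm,
      lintegral_withDensity_eq_lintegral_mul₀ hωm.ennreal_ofReal.aemeasurable
        (hwm.enorm.pow_const p), withDensity_apply _ MeasurableSet.univ,
      Measure.restrict_univ] at h
    have e1 : N = ∫⁻ x in Ω, ((fun x => ENNReal.ofReal (ω x)) * fun x => ‖w x‖ₑ) x := by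
      refine lintegral_congr fun x => ?_
      rw [enorm_mul, Pi.mul_apply, mul_comm, Real.enorm_of_nonneg (hω0 x)]
    have e2 : I = ∫⁻ x in Ω, ((fun x => ENNReal.ofReal (ω x)) * fun x => ‖w x‖ₑ ^ p) x := by
      refine lintegral_congr fun x => ?_
      rw [Pi.mul_apply, ENNReal.ofReal_mul (by positivity), mul_comm,
        ← ENNReal.ofReal_rpow_of_nonneg (abs_nonneg _) hp0.le, ← Real.norm_eq_abs, ofReal_norm]
    rw [e1, e2]
    exact h
  have hNtop : N ≠ ⊤ := by
    intro hNt
    rw [hNt, ENNReal.top_rpow_of_pos hp0, top_le_iff] at hNp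
    exact ENNReal.mul_ne_top (ENNReal.rpow_ne_top_of_nonneg (by linarith) hWtop) hfin.ne hNp
  have hwint : IntegrableOn (fun x => w x * ω x) Ω :=
    ⟨(hwm.mul hωm.aemeasurable).aestronglyMeasurable, lt_top_iff_ne_top.2 hNtop⟩
  set V : ℝ := ∫ x in Ω, ω x with hV
  have hVW : ENNReal.ofReal V = W := by
    rw [hV, ofReal_integral_eq_lintegral_ofReal hωint (ae_of_all _ hω0)]
  have hVpos : 0 < V := by
    rw [← ENNReal.ofReal_pos, hVW]; exact pos_iff_ne_zero.2 hWpos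
  have havg : wAvg Ω a u - c = V⁻¹ * ∫ x in Ω, w x * ω x := by
    have h1 : ∫ x in Ω, u x * ω x = (∫ x in Ω, w x * ω x) + c * V := by
      rw [hV, ← integral_const_mul, ← integral_add hwint (hωint.const_mul c)]
      refine integral_congr_ae (ae_of_all _ fun x => ?_)
      simp only [hw]; ring
    have h2 : wAvg Ω a u = V⁻¹ * ∫ x in Ω, u x * ω x := rfl
    rw [h2, h1]
    field_simp
    ring
  have hconst : wIp Ω Ω p a (fun _ => wAvg Ω a u - c) ≤ I := by
    have e : wIp Ω Ω p a (fun _ => wAvg Ω a u - c) = ‖wAvg Ω a u - c‖ₑ ^ p * W := by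
      rw [hW, ← lintegral_const_mul' _ _
        (ENNReal.rpow_ne_top_of_nonneg hp0.le enorm_ne_top)]
      refine lintegral_congr fun x => ?_
      rw [ENNReal.ofReal_mul (by positivity),
        ← ENNReal.ofReal_rpow_of_nonneg (abs_nonneg _) hp0.le, ← Real.norm_eq_abs, ofReal_norm]
    have h1 : ‖wAvg Ω a u - c‖ₑ ≤ W⁻¹ * N := by
      rw [havg, enorm_mul, Real.enorm_of_nonneg (by positivity), ENNReal.ofReal_inv_of_pos hVpos,
        hVW]
      gcongr
      exact enorm_integral_le_lintegral_enorm _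
    calc wIp Ω Ω p a (fun _ => wAvg Ω a u - c) = ‖wAvg Ω a u - c‖ₑ ^ p * W := e
      _ ≤ (W⁻¹ * N) ^ p * W := by gcongr
      _ = W⁻¹ ^ p * N ^ p * W := by rw [ENNReal.mul_rpow_of_nonneg _ _ hp0.le]
      _ ≤ W⁻¹ ^ p * (W ^ (p - 1) * I) * W := by gcongr
      _ = (W⁻¹ ^ p * (W ^ (p - 1) * W)) * I := by ring
      _ = I := by
        have h3 : W ^ (p - 1) * W = W ^ p := by
          conv_lhs => rw [← ENNReal.rpow_one W, ← ENNReal.rpow_mul, one_mul]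
          rw [← ENNReal.rpow_add _ _ hWpos hWtop]; simp
        rw [h3, ← ENNReal.mul_rpow_of_nonneg _ _ hp0.le, ENNReal.inv_mul_cancel hWpos hWtop,
          ENNReal.one_rpow, one_mul]
  have hadd := wIp_le_add Ω a hp0.le hΩ.measurableSet (K := 1) (L := 1)
    (g := fun x => u x - wAvg Ω a u) (f := w) (h := fun _ => wAvg Ω a u - c)
    measurable_const zero_le_one zero_le_one (fun x _ => by
      have e : u x - wAvg Ω a u = (u x - c) - (wAvg Ω a u - c) := by ring
      rw [one_mul, one_mul, e]
      exact abs_sub _ _)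
  refine hadd.trans ?_
  rw [mul_one, ← mul_add, mul_assoc, two_mul]
  gcongr

/-- The infinitesimal rotation `x ↦ x_j e_i - x_i e_j`. -/
def skewField {n : ℕ} (i j : Fin n) : Evec n →L[ℝ] Evec n :=
  (EuclideanSpace.proj (𝕜 := ℝ) j).smulRight (EuclideanSpace.single i (1 : ℝ)) -
    (EuclideanSpace.proj (𝕜 := ℝ) i).smulRight (EuclideanSpace.single j (1 : ℝ))

theorem skewField_apply {n : ℕ} (i j k : Fin n) (x : Evec n) :
    skewField i j x k = x j * (if k = i then 1 else 0) - x i * (if k = j then 1 else 0) := by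
  simp [skewField, PiLp.single_apply]

theorem abs_skewField_apply_le {n : ℕ} (i j k : Fin n) (x : Evec n) :
    |skewField i j x k| ≤ 2 * ‖x‖ := by
  have hi : |x i| ≤ ‖x‖ := PiLp.norm_apply_le x i
  have hj : |x j| ≤ ‖x‖ := PiLp.norm_apply_le x j
  rw [abs_le] at hi hj ⊢
  rw [skewField_apply]
  split_ifs <;> constructor <;> linarith [hi.1, hi.2, hj.1, hj.2]

theorem skewField_single_antisymm {n : ℕ} (i j k l : Fin n) :
    skewField i j (EuclideanSpace.single l 1) k =
      -skewField i j (EuclideanSpace.single k 1) l := by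
  simp only [skewField_apply, PiLp.single_apply, eq_comm (a := j), eq_comm (a := i)]
  ring

theorem pder_smul_skewField {n : ℕ} (i j k l : Fin n) {w : Evec n → ℝ} {x : Evec n}
    (hw : DifferentiableAt ℝ w x) :
    pder (fun x => w x • skewField i j x) k l x =
      w x * skewField i j (EuclideanSpace.single l 1) k +
        fderiv ℝ w x (EuclideanSpace.single l 1) * skewField i j x k := by
  have h := (hw.hasFDerivAt.smul (skewField i j).hasFDerivAt).fderiv
  have e : (fun x => w x • skewField i j x) = w • ⇑(skewField i j) := rfl
  rw [pder, e, h]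
  simp

theorem abs_fderiv_single_mul_le {n : ℕ} (i j k l : Fin n) (w : Evec n → ℝ) {x : Evec n} {R : ℝ}
    (hx : ‖x‖ ≤ R) :
    |fderiv ℝ w x (EuclideanSpace.single l 1) * skewField i j x k| ≤ 2 * R * gradLen w x := by
  have h1 : |fderiv ℝ w x (EuclideanSpace.single l 1)| ≤ gradLen w x := by
    simpa [gradLen] using (fderiv ℝ w x).le_opNorm (EuclideanSpace.single l 1)
  have h2 := abs_skewField_apply_le i j k x
  rw [abs_mul, mul_comm (2 * R)]
  exact mul_le_mul h1 (by linarith) (abs_nonneg _) (norm_nonneg _)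

theorem sqrt_sum_sum_sq_le {n : ℕ} {f : Fin n → Fin n → ℝ} {B : ℝ} (hB : 0 ≤ B)
    (hf : ∀ i j, |f i j| ≤ B) : Real.sqrt (∑ i, ∑ j, f i j ^ 2) ≤ n * B := by
  apply Real.sqrt_le_iff.2 ⟨by positivity, ?_⟩
  calc ∑ i, ∑ j, f i j ^ 2 ≤ ∑ _i : Fin n, ∑ _j : Fin n, B ^ 2 := by
        refine Finset.sum_le_sum fun i _ => Finset.sum_le_sum fun j _ => ?_
        exact sq_le_sq' (abs_le.1 (hf i j)).1 (abs_le.1 (hf i j)).2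
    _ = (n * B) ^ 2 := by simp; ring

theorem abs_pder_le_DvLen {n : ℕ} (v : Evec n → Evec n) (i j : Fin n) (x : Evec n) :
    |pder v i j x| ≤ DvLen v x := by
  rw [DvLen, ← Real.sqrt_sq_eq_abs]
  apply Real.sqrt_le_sqrt
  refine le_trans ?_ (Finset.single_le_sum
    (f := fun i => ∑ j, pder v i j x ^ 2) (fun i _ => by positivity) (Finset.mem_univ i))
  exact Finset.single_le_sum (f := fun j => pder v i j x ^ 2) (fun i _ => by positivity)
    (Finset.mem_univ j)

theorem DvLen_smul_skewField_le {n : ℕ} (i j : Fin n) {w : Evec n → ℝ} {x : Evec n}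
    (hw : DifferentiableAt ℝ w x) {R : ℝ} (hx : ‖x‖ ≤ R) :
    DvLen (fun x => w x • skewField i j x) x ≤ n * (2 * |w x| + 2 * R * gradLen w x) := by
  have hR : 0 ≤ R := (norm_nonneg x).trans hx
  have hG : 0 ≤ gradLen w x := norm_nonneg _
  refine sqrt_sum_sum_sq_le (by positivity) fun k l => ?_
  rw [pder_smul_skewField i j k l hw]
  refine (abs_add_le _ _).trans (add_le_add ?_ (abs_fderiv_single_mul_le i j k l w hx))
  have h2 := abs_skewField_apply_le i j k (EuclideanSpace.single l 1)
  rw [abs_mul, mul_comm]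
  refine mul_le_mul_of_nonneg_right ?_ (abs_nonneg _)
  simpa using h2

theorem epsLen_smul_skewField_le {n : ℕ} (i j : Fin n) {w : Evec n → ℝ} {x : Evec n}
    (hw : DifferentiableAt ℝ w x) {R : ℝ} (hx : ‖x‖ ≤ R) :
    epsLen (fun x => w x • skewField i j x) x ≤ n * (2 * R * gradLen w x) := by
  have hR : 0 ≤ R := (norm_nonneg x).trans hx
  have hG : 0 ≤ gradLen w x := norm_nonneg _
  refine sqrt_sum_sum_sq_le (by positivity) fun k l => ?_
  rw [pder_smul_skewField i j k l hw, pder_smul_skewField i j l k hw,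
    skewField_single_antisymm i j k l]
  have h1 := abs_le.1 (abs_fderiv_single_mul_le i j k l w hx)
  have h2 := abs_le.1 (abs_fderiv_single_mul_le i j l k w hx)
  rw [abs_le]
  constructor <;> linarith [h1.1, h1.2, h2.1, h2.2]

theorem abs_le_DvLen_smul_skewField {n : ℕ} {i j : Fin n} (hij : i ≠ j) {w : Evec n → ℝ}
    {x : Evec n} (hw : DifferentiableAt ℝ w x) {R : ℝ} (hx : ‖x‖ ≤ R) :
    |w x| ≤ DvLen (fun x => w x • skewField i j x) x + 2 * R * gradLen w x := by
  have h0 := abs_pder_le_DvLen (fun x => w x • skewField i j x) i j x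
  rw [pder_smul_skewField i j i j hw] at h0
  have h1 := abs_le.1 (abs_fderiv_single_mul_le i j i j w hx)
  have e1 : skewField i j (EuclideanSpace.single j 1) i = 1 := by
    simp [skewField_apply, hij]
  rw [e1, abs_le] at h0
  rw [abs_le]
  constructor <;> linarith [h0.1, h0.2, h1.1, h1.2]

theorem epsLen_le_DvLen {n : ℕ} (v : Evec n → Evec n) (x : Evec n) : epsLen v x ≤ DvLen v x := by
  apply Real.sqrt_le_sqrt
  have h : ∑ i, ∑ j, pder v j i x ^ 2 = ∑ i, ∑ j, pder v i j x ^ 2 := Finset.sum_comm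
  calc ∑ i, ∑ j, ((pder v i j x + pder v j i x) / 2) ^ 2
      ≤ ∑ i, ∑ j, (pder v i j x ^ 2 + pder v j i x ^ 2) / 2 := by
        gcongr with i _ j _
        nlinarith [sq_nonneg (pder v i j x - pder v j i x)]
    _ = ∑ i, ∑ j, pder v i j x ^ 2 := by
        simp only [← Finset.sum_div, Finset.sum_add_distrib, h]; ring

theorem continuous_DvLen {n : ℕ} {v : Evec n → Evec n} (hv : ContDiff ℝ 1 v) :
    Continuous (DvLen v) := by
  have h : ∀ i j, Continuous fun x => pder v i j x := fun i j =>
    (EuclideanSpace.proj (𝕜 := ℝ) i).continuous.comp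
      ((hv.continuous_fderiv one_ne_zero).clm_apply continuous_const)
  unfold DvLen
  fun_prop

theorem fderiv_eq_zero_of_DvLen {n : ℕ} {v : Evec n → Evec n} {x : Evec n}
    (h : DvLen v x = 0) : fderiv ℝ v x = 0 := by
  ext y i
  have hp : ∀ j, fderiv ℝ v x (EuclideanSpace.single j 1) i = 0 := fun j => by
    have := abs_pder_le_DvLen v i j x
    rw [h] at this
    exact abs_nonpos_iff.1 this
  have hy : y = ∑ j, y j • EuclideanSpace.single j (1 : ℝ) := by
    ext k; simp [Pi.single_apply]
  rw [hy]
  simp [map_sum, hp]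

theorem IsClosedCube.isCompact {n : ℕ} {Q : Set (Evec n)} (hQ : IsClosedCube Q) :
    IsCompact Q := by
  obtain ⟨c, r, -, rfl⟩ := hQ
  have h := (EuclideanSpace.equiv (Fin n) ℝ).toHomeomorph.isCompact_preimage.2
    (isCompact_univ_pi fun i => isCompact_Icc (a := c i - r) (b := c i + r))
  convert h using 1
  ext x
  simp only [abs_le, mem_ofPred_eq, mem_preimage, mem_univ_pi, mem_Icc]
  refine forall_congr' fun i => ?_
  change _ ↔ c i - r ≤ x i ∧ x i ≤ c i + r
  constructor <;> rintro ⟨h1, h2⟩ <;> constructor <;> linarith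

theorem IsClosedCube.convex {n : ℕ} {Q : Set (Evec n)} (hQ : IsClosedCube Q) : Convex ℝ Q := by
  obtain ⟨c, r, -, rfl⟩ := hQ
  intro x hx y hy s t hs ht hst i
  have h1 := abs_le.1 (hx i)
  have h2 := abs_le.1 (hy i)
  have e : (s • x + t • y) i - c i = s * (x i - c i) + t * (y i - c i) := by
    have : c i = (s + t) * c i := by rw [hst, one_mul]
    simp only [PiLp.add_apply, PiLp.smul_apply, smul_eq_mul]
    linear_combination -this
  rw [e, abs_le]
  have e2 : r = s * r + t * r := by rw [← add_mul, hst, one_mul]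
  constructor
  · nlinarith [mul_le_mul_of_nonneg_left h1.1 hs, mul_le_mul_of_nonneg_left h2.1 ht]
  · nlinarith [mul_le_mul_of_nonneg_left h1.2 hs, mul_le_mul_of_nonneg_left h2.2 ht]

theorem IsClosedCube.volume_ne_zero {n : ℕ} {Q : Set (Evec n)} (hQ : IsClosedCube Q) :
    volume Q ≠ 0 := by
  obtain ⟨c, r, hr, rfl⟩ := hQ
  refine ((Metric.measure_ball_pos volume c hr).trans_le (measure_mono ?_)).ne'
  intro x hx i
  have : ‖(x - c) i‖ ≤ ‖x - c‖ := PiLp.norm_apply_le (x - c) i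
  rw [mem_ball_iff_norm] at hx
  exact this.trans hx.le

theorem weight_exponent_le_of_korn {n : ℕ} (hn : 2 ≤ n) {Ω Q : Set (Evec n)} {p a β C : ℝ}
    (hΩ : IsBoundedDomain Ω) (hp : 0 < p) (ha : 0 ≤ a) (hQ : IsCompact Q) (hQΩ : Q ⊆ Ω)
    (hK : ∀ v : Evec n → Evec n, MemW1Vec Ω p a a v →
      wIp Ω Ω p a (DvLen v) ≤
        ENNReal.ofReal C * (wIp Ω Ω p β (epsLen v) + wIp Ω Q p a (DvLen v))) :
    β ≤ a := by
  by_contra! hβ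
  obtain ⟨hΩo, hΩc, hΩb⟩ := hΩ
  have hne := frontier_nonempty_of_isBoundedDomain hn ⟨hΩo, hΩc, hΩb⟩
  obtain ⟨m, hm, hmQ⟩ : ∃ m > 0, ∀ x ∈ Q, m ≤ bdist Ω x := by
    rcases Q.eq_empty_or_nonempty with rfl | hQne
    · exact ⟨1, one_pos, by simp⟩
    · obtain ⟨x, hx, hmin⟩ := hQ.exists_isMinOn hQne
        (Metric.continuous_infDist_pt (frontier Ω)).continuousOn
      exact ⟨bdist Ω x, bdist_pos hΩo hne (hQΩ hx), fun y hy => hmin hy⟩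
  obtain ⟨δ, hδ, hδm, hδC⟩ : ∃ δ > 0, δ < m ∧ C * δ ^ (β - a) < 1 := by
    have hs : 0 < β - a := by linarith
    have h1 : Tendsto (fun δ : ℝ => C * δ ^ (β - a)) (𝓝 0) (𝓝 (C * 0 ^ (β - a))) :=
      ((Real.continuousAt_rpow_const 0 (β - a) (Or.inr hs.le)).tendsto).const_mul C
    rw [Real.zero_rpow hs.ne', mul_zero] at h1
    have h2 : ∀ᶠ δ : ℝ in 𝓝[>] 0, δ < m ∧ C * δ ^ (β - a) < 1 :=
      ((eventually_lt_nhds hm).and (h1.eventually_lt_const one_pos)).filter_mono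
        nhdsWithin_le_nhds
    obtain ⟨δ, h3, h4⟩ := (h2.and self_mem_nhdsWithin).exists
    exact ⟨δ, h4, h3⟩
  obtain ⟨z, hz⟩ := hne
  obtain ⟨x₀, hx₀, hdist⟩ := Metric.mem_closure_iff.1 (frontier_subset_closure hz) (δ / 2)
    (by linarith)
  obtain ⟨r, hr, hrΩ⟩ := Metric.isOpen_iff.1 hΩo x₀ hx₀
  set s := min (r / 2) (δ / 2) with hs
  have hs0 : 0 < s := lt_min (by linarith) (by linarith)
  let φ : ContDiffBump x₀ := ⟨s / 2, s, by linarith, by linarith⟩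
  let i₀ : Fin n := ⟨0, by lia⟩
  let v : Evec n → Evec n := fun x => φ x • EuclideanSpace.single i₀ (1 : ℝ)
  have hv : ContDiff ℝ 1 v := φ.contDiff.smul contDiff_const
  have hDzero : ∀ x, x ∉ Metric.closedBall x₀ s → DvLen v x = 0 := by
    intro x hx
    have hts : tsupport v ⊆ Metric.closedBall x₀ s := by
      have : tsupport v ⊆ tsupport φ := tsupport_smul_subset_left _ _
      rwa [φ.tsupport_eq] at this
    have : fderiv ℝ v x = 0 := by
      by_contra h
      exact hx (hts (support_fderiv_subset ℝ h))
    simp [DvLen, pder, this]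
  have hball : ∀ x ∈ Metric.closedBall x₀ s, x ∈ Ω ∧ bdist Ω x < δ := by
    intro x hx
    rw [Metric.mem_closedBall] at hx
    refine ⟨hrΩ ?_, ?_⟩
    · rw [Metric.mem_ball]; linarith [min_le_left (r / 2) (δ / 2)]
    · have h1 : bdist Ω x ≤ dist x z := Metric.infDist_le_dist_of_mem hz
      have h2 := dist_triangle x x₀ z
      rw [dist_comm x₀ z] at h2
      linarith [min_le_right (r / 2) (δ / 2)]
  obtain ⟨B, hB⟩ : ∃ B, ∀ x ∈ Ω, |DvLen v x| ≤ B := by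
    obtain ⟨B, hB⟩ := hΩb.isCompact_closure.exists_bound_of_continuousOn
      (continuous_DvLen hv).continuousOn
    exact ⟨B, fun x hx => hB x (subset_closure hx)⟩
  have hfin : wIp Ω Ω p a (DvLen v) < ⊤ :=
    wIp_lt_top_of_bounded hp.le ha hΩo hΩb ⟨z, hz⟩ hB
  have hmem : MemW1Vec Ω p a a v := by
    refine ⟨(hv.differentiable one_ne_zero).differentiableOn,
      wIp_lt_top_of_bounded hp.le ha hΩo hΩb ⟨z, hz⟩ (K := 1) fun x _ => ?_, hfin⟩
    simp only [v, norm_smul, PiLp.norm_single, norm_one, mul_one, Real.norm_eq_abs, abs_abs]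
    rw [abs_of_nonneg φ.nonneg]
    exact φ.le_one
  have hkorn := hK v hmem
  have hQ0 : wIp Ω Q p a (DvLen v) = 0 := by
    rw [wIp, setLIntegral_congr_fun hQ.measurableSet (g := fun _ => 0)]
    · simp
    · intro x hx
      have hx' : x ∉ Metric.closedBall x₀ s := fun h =>
        absurd (hball x h).2 (by linarith [hmQ x hx])
      simp [hDzero x hx', Real.zero_rpow hp.ne']
  have heps : wIp Ω Ω p β (epsLen v) ≤
      ENNReal.ofReal (δ ^ (β - a)) * wIp Ω Ω p a (DvLen v) := by
    simp only [wIp]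
    rw [← lintegral_const_mul' _ _ ENNReal.ofReal_ne_top]
    refine setLIntegral_mono' hΩo.measurableSet fun x hx => ?_
    rw [← ENNReal.ofReal_mul (by positivity)]
    apply ENNReal.ofReal_le_ofReal
    have heps0 : 0 ≤ epsLen v x := Real.sqrt_nonneg _
    have hle := epsLen_le_DvLen v x
    by_cases hxb : x ∈ Metric.closedBall x₀ s
    · have hρ := bdist_pos hΩo ⟨z, hz⟩ hx
      have e : bdist Ω x ^ β = bdist Ω x ^ (β - a) * bdist Ω x ^ a := by
        rw [← Real.rpow_add hρ]; simp
      have h1 : bdist Ω x ^ (β - a) ≤ δ ^ (β - a) :=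
        Real.rpow_le_rpow hρ.le (hball x hxb).2.le (by linarith)
      have h2 : |epsLen v x| ^ p ≤ |DvLen v x| ^ p := by
        refine Real.rpow_le_rpow (abs_nonneg _) ?_ hp.le
        rwa [abs_of_nonneg heps0, abs_of_nonneg (heps0.trans hle)]
      rw [e, mul_left_comm]
      gcongr
    · have h0 := hDzero x hxb
      have h1 : epsLen v x = 0 := le_antisymm (h0 ▸ hle) heps0
      simp [h0, h1, Real.zero_rpow hp.ne']
  have hI : wIp Ω Ω p a (DvLen v) = 0 := by
    by_contra hI0
    have h1 : wIp Ω Ω p a (DvLen v) ≤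
        ENNReal.ofReal (C * δ ^ (β - a)) * wIp Ω Ω p a (DvLen v) := by
      rw [ENNReal.ofReal_mul' (by positivity), mul_assoc]
      refine hkorn.trans ?_
      rw [hQ0, add_zero]
      gcongr
    have h2 : ENNReal.ofReal (C * δ ^ (β - a)) * wIp Ω Ω p a (DvLen v) <
        1 * wIp Ω Ω p a (DvLen v) :=
      ENNReal.mul_lt_mul_left hI0 hfin.ne (by rwa [ENNReal.ofReal_lt_one])
    rw [one_mul] at h2
    exact absurd h1 (not_le.2 h2)
  have hDm : Measurable fun x => ENNReal.ofReal (|DvLen v x| ^ p * bdist Ω x ^ a) :=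
    (((continuous_DvLen hv).abs.measurable.pow_const p).mul
      ((measurable_bdist Ω).pow_const a)).ennreal_ofReal
  rw [wIp, lintegral_eq_zero_iff hDm, Filter.EventuallyEq,
    ae_restrict_iff' hΩo.measurableSet] at hI
  have hae : DvLen v =ᵐ[volume] fun _ => 0 := by
    filter_upwards [hI] with x hx
    by_cases hxΩ : x ∈ Ω
    · have h1 := hx hxΩ
      simp only [Pi.zero_apply, ENNReal.ofReal_eq_zero] at h1
      by_contra h2
      have : 0 < bdist Ω x ^ a := Real.rpow_pos_of_pos (bdist_pos hΩo ⟨z, hz⟩ hxΩ) a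
      have h3 : 0 < |DvLen v x| ^ p := Real.rpow_pos_of_pos (abs_pos.2 h2) p
      exact absurd h1 (not_le.2 (mul_pos h3 this))
    · exact hDzero x fun h => hxΩ (hball x h).1
  have hall : DvLen v = fun _ => 0 :=
    (continuous_DvLen hv).ae_eq_iff_eq volume continuous_const |>.1 hae
  have hconst := is_const_of_fderiv_eq_zero (𝕜 := ℝ) (hv.differentiable one_ne_zero)
    (fun x => fderiv_eq_zero_of_DvLen (congrFun hall x)) x₀ z
  have h1 : φ x₀ = 1 := φ.one_of_mem_closedBall
    (Metric.mem_closedBall_self φ.rIn_pos.le)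
  have hzΩ : z ∉ Ω := by
    rw [hΩo.frontier_eq] at hz; exact hz.2
  have h2 : φ z = 0 := by
    refine φ.zero_of_le_dist ?_
    by_contra! h
    exact hzΩ (hball z (Metric.mem_closedBall.2 h.le)).1
  have h3 := congrArg (fun y : Evec n => y i₀) hconst
  simp [v, h1, h2] at h3

/-- **Remark (weighted converse).** If the weighted Korn inequality
`∫_Ω |Dv|^p ρ^a ≤ C { ∫_Ω |ε(v)|^p ρ^{b−p} + ∫_Q |Dv|^p ρ^a }` holds for all
`v ∈ W^{1,p}(Ω,ρ^a)ⁿ` and some cube `Q ⊂⊂ Ω`, then the weighted Poincaré inequality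
`∫_Ω |u − u_{Ω,a}|^p ρ^a ≤ C' ∫_Ω |∇u|^p ρ^{b−p}` holds for all
`u ∈ W^{1,p}(Ω,ρ^a,ρ^{b−p})`. -/
theorem weighted_korn_implies_weighted_poincare {n : ℕ} (hn : 2 ≤ n) (Ω Q : Set (Evec n))
    (p a b : ℝ) (hΩ : IsBoundedDomain Ω) (hp : 1 < p) (ha : 0 ≤ a)
    (hQ : IsClosedCube Q) (hQΩ : Q ⊆ Ω) (C : ℝ)
    (hK : ∀ v : Evec n → Evec n, MemW1Vec Ω p a a v →
      wIp Ω Ω p a (DvLen v) ≤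
        ENNReal.ofReal C * (wIp Ω Ω p (b - p) (epsLen v) + wIp Ω Q p a (DvLen v))) :
    ∃ C' > 0, ∀ u : Evec n → ℝ, MemW1 Ω p a (b - p) u →
      wIp Ω Ω p a (fun x => u x - wAvg Ω a u) ≤
        ENNReal.ofReal C' * wIp Ω Ω p (b - p) (gradLen u) := by
  obtain ⟨hΩo, hΩc, hΩb⟩ := hΩ
  have hne := frontier_nonempty_of_isBoundedDomain hn ⟨hΩo, hΩc, hΩb⟩
  have hp0 : 0 < p := by linarith
  have hβ : b - p ≤ a :=
    weight_exponent_le_of_korn hn ⟨hΩo, hΩc, hΩb⟩ hp0 ha hQ.isCompact hQΩ hK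
  have hΩm := hΩo.measurableSet
  have hQm := hQ.isCompact.measurableSet
  obtain ⟨M, hM, hMle⟩ := exists_bdist_rpow_le_of_bounded hΩo hΩb hne hβ
  obtain ⟨M₁, hM₁, hM₁le⟩ := exists_bdist_rpow_le_of_isCompact hΩo hne hQ.isCompact hQΩ a 0
  obtain ⟨M₂, hM₂, hM₂le⟩ := exists_bdist_rpow_le_of_isCompact hΩo hne hQ.isCompact hQΩ 0 (b - p)
  obtain ⟨R, hR, hRle⟩ : ∃ R : ℝ, 0 ≤ R ∧ ∀ x ∈ Ω, ‖x‖ ≤ R := by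
    obtain ⟨R, hR⟩ := hΩb.exists_norm_le
    exact ⟨|R|, abs_nonneg R, fun x hx => (hR x hx).trans (le_abs_self R)⟩
  obtain ⟨K, hK_top, hPoincare⟩ := exists_lintegral_sub_le_of_convex hΩo hQΩ hQ.convex
    hQ.isCompact hQ.volume_ne_zero hp
  let i : Fin n := ⟨0, by lia⟩
  let j : Fin n := ⟨1, by lia⟩
  have hij : i ≠ j := by simp [i, j]
  set c₁ : ℝ≥0∞ := ENNReal.ofReal ((2 * 1) ^ p)
  set c₂ : ℝ≥0∞ := ENNReal.ofReal ((2 * (2 * R)) ^ p)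
  set c₃ : ℝ≥0∞ := ENNReal.ofReal ((n * (2 * R)) ^ p)
  set c₄ : ℝ≥0∞ := ENNReal.ofReal ((2 * (n * 2)) ^ p)
  set c₅ : ℝ≥0∞ := ENNReal.ofReal ((2 * (n * (2 * R))) ^ p)
  set c₆ : ℝ≥0∞ := ENNReal.ofReal M
  set T : ℝ≥0∞ := c₁ * (ENNReal.ofReal C * (c₃ + (c₄ * (ENNReal.ofReal M₁ *
    (K * ENNReal.ofReal M₂)) + c₅ * c₆))) + c₂ * c₆ with hT
  set T' : ℝ≥0∞ := ENNReal.ofReal (2 ^ p) * 2 * T with hT'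
  have hT'top : T' ≠ ⊤ := by finiteness
  refine ⟨T'.toReal + 1, by positivity, fun u ⟨hud, hua, hub⟩ => ?_⟩
  obtain ⟨c, hc⟩ := hPoincare u hud
  set G := gradLen u with hG
  have hGm : Measurable G := (measurable_fderiv ℝ u).norm
  have hG0 : ∀ x, 0 ≤ G x := fun x => norm_nonneg _
  let w : Evec n → ℝ := fun x => u x - c
  let v : Evec n → Evec n := fun x => w x • skewField i j x
  have hwd : DifferentiableOn ℝ w Ω := hud.sub_const c
  have hwat : ∀ x ∈ Ω, DifferentiableAt ℝ w x := fun x hx =>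
    hwd.differentiableAt (hΩo.mem_nhds hx)
  have hGw : gradLen w = G := by
    ext x; simp only [hG, gradLen, w, fderiv_sub_const]
  have hDv0 : ∀ x, |DvLen v x| = DvLen v x := fun x => abs_of_nonneg (Real.sqrt_nonneg _)
  have hGabs : ∀ x, |G x| = G x := fun x => abs_of_nonneg (hG0 x)
  have hGa : wIp Ω Ω p a G ≤ c₆ * wIp Ω Ω p (b - p) G := wIp_le_of_weight_le Ω p hΩm G hM hMle
  have hDv_le : ∀ x ∈ Ω, |DvLen v x| ≤ n * 2 * |w x| + n * (2 * R) * |G x| := fun x hx => by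
    have h := DvLen_smul_skewField_le i j (hwat x hx) (hRle x hx)
    rw [hGw] at h
    rw [hDv0, hGabs]
    linarith
  have hwfin : wIp Ω Ω p a w < ⊤ := by
    refine (wIp_le_add Ω a hp0.le hΩm (f := u) (h := fun _ => c) measurable_const zero_le_one
      zero_le_one (fun x _ => ?_)).trans_lt ?_
    · rw [one_mul, one_mul]; exact abs_sub _ _
    · have := (wIp_lt_top_of_bounded hp0.le ha hΩo hΩb hne (g := fun _ => c) (K := |c|)
        fun _ _ => le_rfl).ne
      have := hua.ne
      finiteness
  have hGafin : wIp Ω Ω p a G < ⊤ := by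
    refine hGa.trans_lt ?_
    have := hub.ne
    finiteness
  have hvmem : MemW1Vec Ω p a a v := by
    refine ⟨hwd.smul (skewField i j).differentiable.differentiableOn, ?_, ?_⟩
    · refine (wIp_le_mul Ω a hp0.le hΩm (f := w) (K := ‖skewField i j‖ * R) (by positivity)
        fun x hx => ?_).trans_lt (ENNReal.mul_lt_top ENNReal.ofReal_lt_top hwfin)
      rw [abs_norm, norm_smul, mul_comm, Real.norm_eq_abs]
      gcongr
      exact (skewField i j).le_opNorm_of_le (hRle x hx)
    · refine (wIp_le_add Ω a hp0.le hΩm hGm (by positivity) (by positivity) hDv_le).trans_lt ?_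
      have := hwfin.ne
      have := hGafin.ne
      finiteness
  have heps : wIp Ω Ω p (b - p) (epsLen v) ≤ c₃ * wIp Ω Ω p (b - p) G := by
    refine wIp_le_mul Ω _ hp0.le hΩm (by positivity) fun x hx => ?_
    have h := epsLen_smul_skewField_le i j (hwat x hx) (hRle x hx)
    rw [hGw] at h
    have h0 : 0 ≤ epsLen v x := Real.sqrt_nonneg _
    rw [hGabs, abs_of_nonneg h0, mul_assoc]
    exact h
  have hQw : wIp Ω Q p a w ≤
      ENNReal.ofReal M₁ * (K * ENNReal.ofReal M₂) * wIp Ω Ω p (b - p) G := by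
    have hc' : wIp Ω Q p 0 w ≤ K * wIp Ω Q p 0 G := by
      simpa [wIp, w, hGabs] using hc
    calc wIp Ω Q p a w ≤ ENNReal.ofReal M₁ * wIp Ω Q p 0 w :=
          wIp_le_of_weight_le Ω p hQm w hM₁ hM₁le
      _ ≤ ENNReal.ofReal M₁ * (K * (ENNReal.ofReal M₂ * wIp Ω Ω p (b - p) G)) := by
          gcongr
          refine hc'.trans ?_
          gcongr
          refine (wIp_le_of_weight_le Ω p hQm G hM₂ hM₂le).trans ?_
          gcongr
          exact wIp_mono_set Ω p (b - p) hQΩ G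
      _ = _ := by ring
  have hQv : wIp Ω Q p a (DvLen v) ≤ (c₄ * (ENNReal.ofReal M₁ * (K * ENNReal.ofReal M₂)) +
      c₅ * c₆) * wIp Ω Ω p (b - p) G := by
    calc wIp Ω Q p a (DvLen v) ≤ c₄ * wIp Ω Q p a w + c₅ * wIp Ω Q p a G :=
          wIp_le_add Ω a hp0.le hQm hGm (by positivity) (by positivity)
            fun x hx => hDv_le x (hQΩ hx)
      _ ≤ c₄ * (ENNReal.ofReal M₁ * (K * ENNReal.ofReal M₂) * wIp Ω Ω p (b - p) G) +
            c₅ * (c₆ * wIp Ω Ω p (b - p) G) := by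
          gcongr
          exact (wIp_mono_set Ω p a hQΩ G).trans hGa
      _ = _ := by ring
  have hw_le : wIp Ω Ω p a w ≤ T * wIp Ω Ω p (b - p) G := by
    calc wIp Ω Ω p a w ≤ c₁ * wIp Ω Ω p a (DvLen v) + c₂ * wIp Ω Ω p a G := by
          refine wIp_le_add Ω a hp0.le hΩm hGm zero_le_one (by positivity) fun x hx => ?_
          have h := abs_le_DvLen_smul_skewField hij (hwat x hx) (hRle x hx)
          rw [hGw] at h
          rw [hDv0, hGabs, one_mul]
          exact h
      _ ≤ c₁ * (ENNReal.ofReal C * (c₃ * wIp Ω Ω p (b - p) G +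
            (c₄ * (ENNReal.ofReal M₁ * (K * ENNReal.ofReal M₂)) + c₅ * c₆) *
              wIp Ω Ω p (b - p) G)) + c₂ * (c₆ * wIp Ω Ω p (b - p) G) := by
          gcongr
          refine (hK v hvmem).trans ?_
          gcongr
      _ = T * wIp Ω Ω p (b - p) G := by rw [hT]; ring
  calc wIp Ω Ω p a (fun x => u x - wAvg Ω a u)
      ≤ ENNReal.ofReal (2 ^ p) * 2 * wIp Ω Ω p a w :=
        wIp_sub_wAvg_le hΩo hΩc.nonempty hΩb hne hp ha hud.continuousOn hwfin
    _ ≤ ENNReal.ofReal (2 ^ p) * 2 * (T * wIp Ω Ω p (b - p) G) := by gcongr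
    _ = T' * wIp Ω Ω p (b - p) G := by rw [hT']; ring
    _ ≤ ENNReal.ofReal (T'.toReal + 1) * wIp Ω Ω p (b - p) G := by
        gcongr
        rw [← ENNReal.ofReal_toReal hT'top]
        exact ENNReal.ofReal_le_ofReal (by simp)
end
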